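/- arXiv:1510.04731 — 5 statements merged into one kernel-verified Lean document; each statement's English description precedes it below -/
import Mathlib

section
/- (Lemma 1, log-convex case) Let X₁, X₂, … be i.i.d. nonnegative integrable random variables with common tail distribution F̄(x) = P(X > x), and let X_{1:r} = min(X₁, …, X_r). If F̄ is log-convex on [0,∞), then the sequence r ↦ r · E[X_{1:r}] is non-increasing in r: for every r ≥ 1, r · E[X_{1:r}] ≥ (r+1) · E[X_{1:r+1}]. Equivalently, since E[X_{1:r}] = ∫₀^∞ F̄(x)^r dx, the sequence r ↦ r · ∫₀^∞ F̄(x)^r dx is non-increasing. -/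
open MeasureTheory ProbabilityTheory

section TailOfMin

variable {Ω : Type*} [MeasurableSpace Ω] {μ : Measure Ω}

/-- The tail `t ↦ μ {f > t}` of a nonnegative integrable function is integrable on `(0, ∞)`. -/
lemma integrableOn_measureReal_lt {f : Ω → ℝ} (hf : Integrable f μ) (hf0 : 0 ≤ᵐ[μ] f) :
    IntegrableOn (fun t => μ.real {ω | t < f ω}) (Set.Ioi 0) := by
  have hmono : Antitone fun t : ℝ => μ {ω | t < f ω} :=
    fun s t hst => measure_mono fun ω hω => hst.trans_lt hω
  refine integrable_toReal_of_lintegral_ne_top hmono.measurable.aemeasurable ?_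
  rw [← lintegral_eq_lintegral_meas_lt μ hf0 hf.aemeasurable]
  exact hf.lintegral_lt_top.ne

lemma lt_ciInf_iff_of_finite {ι : Type*} [Finite ι] [Nonempty ι] {f : ι → ℝ} {t : ℝ} :
    t < ⨅ i, f i ↔ ∀ i, t < f i := by
  obtain ⟨j, hj⟩ := exists_eq_ciInf_of_finite (f := f)
  exact ⟨fun h i => h.trans_le (ciInf_le (Set.finite_range f).bddBelow i), fun h => hj ▸ h j⟩

/-- The tail of the minimum of `r` i.i.d. random variables is the `r`-th power of their tail. -/
lemma measureReal_lt_iInf_of_iIndepFun {X : ℕ → Ω → ℝ} (hindep : iIndepFun X μ)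
    (hident : ∀ i, IdentDistrib (X i) (X 0) μ μ) {r : ℕ} (hr : 1 ≤ r) (t : ℝ) :
    μ.real {ω | t < ⨅ i : Fin r, X i ω} = μ.real {ω | t < X 0 ω} ^ r := by
  have : Nonempty (Fin r) := ⟨⟨0, hr⟩⟩
  have hset : {ω | t < ⨅ i : Fin r, X i ω} = ⋂ i ∈ Finset.range r, X i ⁻¹' Set.Ioi t := by
    ext ω
    simp [lt_ciInf_iff_of_finite, Fin.forall_iff]
  have htail (i : ℕ) : μ (X i ⁻¹' Set.Ioi t) = μ {ω | t < X 0 ω} :=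
    (hident i).measure_mem_eq measurableSet_Ioi
  rw [measureReal_def, hset, hindep.measure_inter_preimage_eq_mul (Finset.range r)
    (sets := fun _ => Set.Ioi t) fun _ _ => measurableSet_Ioi]
  simp [measureReal_def, htail]

lemma integrable_iInf_of_nonneg {X : ℕ → Ω → ℝ} (hX : ∀ i, Measurable (X i))
    (hnonneg : ∀ i ω, 0 ≤ X i ω) (hint : Integrable (X 0) μ) {r : ℕ} (hr : 1 ≤ r) :
    Integrable (fun ω => ⨅ i : Fin r, X i ω) μ := by
  refine hint.mono' (Measurable.iInf fun i : Fin r => hX i).aestronglyMeasurable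
    (.of_forall fun ω => ?_)
  rw [Real.norm_of_nonneg (Real.iInf_nonneg fun i : Fin r => hnonneg i ω)]
  exact ciInf_le (Set.finite_range fun i : Fin r => X i ω).bddBelow ⟨0, hr⟩

end TailOfMin

/-- If `F ≤ 1` is log-convex on `[0, ∞)`, then `F (r / (r + 1) * y) ^ (r + 1) ≤ F y ^ r`. -/
lemma pow_succ_le_pow_of_logConvex {F : ℝ → ℝ} (hF0 : ∀ x, 0 ≤ F x) (hF1 : F 0 ≤ 1)
    (hlogconvex : ∀ x ≥ (0:ℝ), ∀ y ≥ (0:ℝ), ∀ θ ∈ Set.Icc (0:ℝ) 1,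
      F (θ * x + (1 - θ) * y) ≤ F x ^ θ * F y ^ (1 - θ))
    (r : ℕ) {y : ℝ} (hy : 0 ≤ y) :
    F ((r : ℝ) / (r + 1) * y) ^ (r + 1) ≤ F y ^ r := by
  set θ : ℝ := (r : ℝ) / (r + 1) with hθ
  have hθ0 : 0 ≤ θ := by positivity
  have hθ1 : θ ≤ 1 := div_le_one_of_le₀ (by linarith) (by positivity)
  have hle : F (θ * y) ≤ F y ^ θ :=
    calc F (θ * y) ≤ F y ^ θ * F 0 ^ (1 - θ) := by
          simpa using hlogconvex y hy 0 le_rfl θ ⟨hθ0, hθ1⟩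
      _ ≤ F y ^ θ := mul_le_of_le_one_right (Real.rpow_nonneg (hF0 y) _)
          (Real.rpow_le_one (hF0 0) hF1 (by linarith))
  calc F (θ * y) ^ (r + 1) ≤ (F y ^ θ) ^ (r + 1) := pow_le_pow_left₀ (hF0 _) hle _
    _ = F y ^ r := by
      rw [← Real.rpow_mul_natCast (hF0 y), ← Real.rpow_natCast (F y) r, hθ]
      congr 1
      push_cast
      field_simp

/-- Lemma 1 (log-convex case): for i.i.d. nonnegative integrable service times
`X₁, X₂, …` whose common tail distribution `F̄(x) = P(X > x)` is log-convex on
`[0, ∞)`, the sequence `r ↦ r · E[X_{1:r}]` is non-increasing, where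
`X_{1:r} = min(X₁, …, X_r)`. -/
theorem r_mul_exp_min_antitone_of_logConvex_tail
    {Ω : Type*} [MeasurableSpace Ω] (μ : Measure Ω) [IsProbabilityMeasure μ]
    (X : ℕ → Ω → ℝ) (hX : ∀ i, Measurable (X i))
    (hindep : iIndepFun (m := fun _ => Real.measurableSpace) X μ)
    (hident : ∀ i, IdentDistrib (X i) (X 0) μ μ)
    (hnonneg : ∀ i ω, 0 ≤ X i ω)
    (hint : Integrable (X 0) μ)
    (F : ℝ → ℝ) (hF : ∀ x, F x = (μ {ω | X 0 ω > x}).toReal)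
    (hlogconvex : ∀ x ≥ (0:ℝ), ∀ y ≥ (0:ℝ), ∀ θ ∈ Set.Icc (0:ℝ) 1,
      F (θ * x + (1 - θ) * y) ≤ F x ^ θ * F y ^ (1 - θ)) :
    ∀ r : ℕ, 1 ≤ r →
      ((r : ℝ) + 1) * ∫ ω, (⨅ i : Fin (r + 1), X i ω) ∂μ ≤
        (r : ℝ) * ∫ ω, (⨅ i : Fin r, X i ω) ∂μ := by
  intro r hr
  have hF' (x : ℝ) : F x = μ.real {ω | x < X 0 ω} := hF x
  have hF0 (x : ℝ) : 0 ≤ F x := hF' x ▸ measureReal_nonneg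
  have hF1 : F 0 ≤ 1 := hF' 0 ▸ measureReal_le_one
  have hnn (k : ℕ) : 0 ≤ᵐ[μ] fun ω => ⨅ i : Fin k, X i ω :=
    .of_forall fun ω => Real.iInf_nonneg fun i => hnonneg i ω
  have htail {k : ℕ} (hk : 1 ≤ k) (t : ℝ) : μ.real {ω | t < ⨅ i : Fin k, X i ω} = F t ^ k := by
    rw [measureReal_lt_iInf_of_iIndepFun hindep hident hk, hF']
  have hmean {k : ℕ} (hk : 1 ≤ k) :
      ∫ ω, (⨅ i : Fin k, X i ω) ∂μ = ∫ t in Set.Ioi (0 : ℝ), F t ^ k := by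
    rw [(integrable_iInf_of_nonneg hX hnonneg hint hk).integral_eq_integral_meas_lt (hnn k)]
    simp_rw [htail hk]
  have hFint : IntegrableOn (fun t => F t ^ r) (Set.Ioi 0) := by
    simpa only [htail hr] using
      integrableOn_measureReal_lt (integrable_iInf_of_nonneg hX hnonneg hint hr) (hnn r)
  have hrpos : (0 : ℝ) < r := by exact_mod_cast hr
  have hscale := integral_comp_mul_left_Ioi' (fun t => F t ^ (r + 1)) 0
    (b := (r : ℝ) / (r + 1)) (by positivity)
  rw [mul_zero, smul_eq_mul] at hscale
  rw [hmean hr, hmean (Nat.le_add_left 1 r), ← hscale, ← mul_assoc,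
    mul_div_cancel₀ _ (by positivity)]
  refine mul_le_mul_of_nonneg_left (integral_mono_of_nonneg
    (.of_forall fun y => pow_nonneg (hF0 _) _) hFint ?_) hrpos.le
  filter_upwards [ae_restrict_mem measurableSet_Ioi] with y hy
  exact pow_succ_le_pow_of_logConvex hF0 hF1 hlogconvex r (le_of_lt hy)
end

section
/- (Corollary 3, cost comparison of fork-join vs. fork-early-cancel, log-convex case) Let X₁, …, Xₙ be i.i.d. nonnegative integrable random variables with common tail distribution F̄(x) = P(X > x), and let X_{1:n} = min(X₁, …, Xₙ). If F̄ is log-convex on [0,∞), then n · E[X_{1:n}] ≤ E[X₁]; that is, the expected computing cost n · E[X_{1:n}] of the (n,1) fork-join system is at most the expected computing cost E[X] of the (n,1) fork-early-cancel system. -/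
open MeasureTheory ProbabilityTheory

/-- If the tail of the real random variable `X` is dominated by the tail of the integrable random
variable `Y` on `(0, ∞)`, both nonnegative, then `E[X] ≤ E[Y]`. -/
theorem integral_le_integral_of_tail_le {Ω : Type*} [MeasurableSpace Ω] {μ : Measure Ω}
    {X Y : Ω → ℝ} (hX : AEMeasurable X μ) (hX0 : 0 ≤ᵐ[μ] X) (hY0 : 0 ≤ᵐ[μ] Y)
    (hY : Integrable Y μ) (h : ∀ t > 0, μ {ω | t < X ω} ≤ μ {ω | t < Y ω}) :
    ∫ ω, X ω ∂μ ≤ ∫ ω, Y ω ∂μ := by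
  rw [integral_eq_lintegral_of_nonneg_ae hX0 hX.aestronglyMeasurable,
    integral_eq_lintegral_of_nonneg_ae hY0 hY.aestronglyMeasurable]
  refine ENNReal.toReal_mono hY.lintegral_lt_top.ne ?_
  rw [lintegral_eq_lintegral_meas_lt μ hX0 hX, lintegral_eq_lintegral_meas_lt μ hY0 hY.aemeasurable]
  exact setLIntegral_mono' measurableSet_Ioi h

/-- The tail of the minimum of finitely many i.i.d. random variables is a power of the common
tail. -/
theorem measure_lt_iInf_of_iid {Ω ι : Type*} [MeasurableSpace Ω] {μ : Measure Ω} [Fintype ι]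
    [Nonempty ι] {X : ι → Ω → ℝ} (hindep : iIndepFun X μ) (i₀ : ι)
    (hident : ∀ i, IdentDistrib (X i) (X i₀) μ μ) (t : ℝ) :
    μ {ω | t < ⨅ i, X i ω} = μ {ω | t < X i₀ ω} ^ Fintype.card ι := by
  have hset : {ω | t < ⨅ i, X i ω} = ⋂ i ∈ Finset.univ, X i ⁻¹' Set.Ioi t := by
    ext ω
    simp only [Set.mem_ofPred_eq, Finset.mem_univ, Set.iInter_true, Set.mem_iInter, Set.mem_preimage,
      Set.mem_Ioi]
    refine ⟨fun h i => h.trans_le (ciInf_le (Set.finite_range _).bddBelow i), fun h => ?_⟩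
    obtain ⟨i, hi⟩ := exists_eq_ciInf_of_finite (f := fun i => X i ω)
    exact hi ▸ h i
  rw [hset, hindep.measure_inter_preimage_eq_mul Finset.univ fun _ _ => measurableSet_Ioi,
    Finset.prod_congr rfl fun i _ => (hident i).measure_mem_eq measurableSet_Ioi,
    Finset.prod_const, Finset.card_univ]
  rfl

/-- A log-convex function on `[0, ∞)` with values in `[0, 1]` satisfies `F (t / n) ^ n ≤ F t`. -/
theorem pow_div_le_of_logConvex {F : ℝ → ℝ} (hF0 : ∀ x, 0 ≤ F x) (hF1 : F 0 ≤ 1)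
    (hlogconvex : ∀ x ≥ (0:ℝ), ∀ y ≥ (0:ℝ), ∀ θ ∈ Set.Icc (0:ℝ) 1,
      F (θ * x + (1 - θ) * y) ≤ F x ^ θ * F y ^ (1 - θ))
    {n : ℕ} (hn : 0 < n) {t : ℝ} (ht : 0 ≤ t) : F (t / n) ^ n ≤ F t := by
  have hθ : (n : ℝ)⁻¹ ≤ 1 := inv_le_one_of_one_le₀ (by exact_mod_cast hn)
  have h := hlogconvex t ht 0 le_rfl (n : ℝ)⁻¹ ⟨by positivity, hθ⟩
  rw [mul_zero, add_zero, inv_mul_eq_div] at h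
  have hroot : F (t / n) ≤ F t ^ (n : ℝ)⁻¹ :=
    h.trans (mul_le_of_le_one_right (Real.rpow_nonneg (hF0 t) _)
      (Real.rpow_le_one (hF0 0) hF1 (sub_nonneg.2 hθ)))
  calc F (t / n) ^ n ≤ (F t ^ (n : ℝ)⁻¹) ^ n := pow_le_pow_left₀ (hF0 _) hroot n
    _ = F t := Real.rpow_inv_natCast_pow (hF0 t) hn.ne'

/-- Corollary 3 (log-convex case): for i.i.d. nonnegative integrable service times
`X₁, …, Xₙ` whose common tail distribution `F̄(x) = P(X > x)` is log-convex on
`[0, ∞)`, the expected computing cost `n · E[X_{1:n}]` of the `(n,1)` fork-join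
system is at most the expected cost `E[X]` of the `(n,1)` fork-early-cancel
system. -/
theorem fork_join_cost_le_early_cancel_of_logConvex_tail
    {Ω : Type*} [MeasurableSpace Ω] (μ : Measure Ω) [IsProbabilityMeasure μ]
    {n : ℕ} (hn : 0 < n)
    (X : Fin n → Ω → ℝ) (hX : ∀ i, Measurable (X i))
    (hindep : iIndepFun (m := fun _ => Real.measurableSpace) X μ)
    (hident : ∀ i, IdentDistrib (X i) (X ⟨0, hn⟩) μ μ)
    (hnonneg : ∀ i ω, 0 ≤ X i ω)
    (hint : Integrable (X ⟨0, hn⟩) μ)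
    (F : ℝ → ℝ) (hF : ∀ x, F x = (μ {ω | X ⟨0, hn⟩ ω > x}).toReal)
    (hlogconvex : ∀ x ≥ (0:ℝ), ∀ y ≥ (0:ℝ), ∀ θ ∈ Set.Icc (0:ℝ) 1,
      F (θ * x + (1 - θ) * y) ≤ F x ^ θ * F y ^ (1 - θ)) :
    (n : ℝ) * ∫ ω, (⨅ i, X i ω) ∂μ ≤ ∫ ω, X ⟨0, hn⟩ ω ∂μ := by
  have : Nonempty (Fin n) := ⟨⟨0, hn⟩⟩
  have hn' : (0 : ℝ) < n := by exact_mod_cast hn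
  rw [← integral_const_mul]
  refine integral_le_integral_of_tail_le ((Measurable.iInf hX).const_mul _).aemeasurable
    (ae_of_all _ fun ω => mul_nonneg hn'.le (Real.iInf_nonneg fun i => hnonneg i ω))
    (ae_of_all _ (hnonneg _)) hint fun t ht => ?_
  have hscale : {ω | t < n * ⨅ i, X i ω} = {ω | t / n < ⨅ i, X i ω} := by
    ext ω
    exact (div_lt_iff₀' hn').symm
  rw [hscale, measure_lt_iInf_of_iid hindep ⟨0, hn⟩ hident, Fintype.card_fin,
    ← ENNReal.toReal_le_toReal (ENNReal.pow_ne_top (measure_ne_top _ _)) (measure_ne_top _ _),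
    ENNReal.toReal_pow]
  have h := pow_div_le_of_logConvex (fun x => hF x ▸ ENNReal.toReal_nonneg)
    (hF 0 ▸ measureReal_le_one) hlogconvex hn ht.le
  rwa [hF, hF] at h
end

section
/- (Theorem 3, log-convex lower bound) Let r ≥ 1, let X₁, …, X_r be i.i.d. nonnegative integrable random variables with common tail distribution F̄(x) = P(X > x) which is log-convex on [0,∞), and let 0 = t₁ ≤ t₂ ≤ … ≤ t_r be real numbers (relative task start times). Define S = min₁≤i≤r (Xᵢ + tᵢ) and the computing cost C = Σ₁≤i≤r max(S − tᵢ, 0). Then E[C] ≥ r · E[X_{1:r}], where X_{1:r} = min(X₁, …, X_r). -/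
open MeasureTheory ProbabilityTheory

/-- First-order stochastic dominance of nonnegative functions implies the inequality of means. -/
theorem integral_le_integral_of_measure_lt_le {Ω : Type*} [MeasurableSpace Ω] {μ : Measure Ω}
    {f g : Ω → ℝ} (hf : Measurable f) (hf0 : ∀ ω, 0 ≤ f ω) (hg : Integrable g μ)
    (hg0 : ∀ ω, 0 ≤ g ω) (h : ∀ w > 0, μ {ω | w < f ω} ≤ μ {ω | w < g ω}) :
    ∫ ω, f ω ∂μ ≤ ∫ ω, g ω ∂μ := by
  rw [integral_eq_lintegral_of_nonneg_ae (.of_forall hf0) hf.aestronglyMeasurable,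
    integral_eq_lintegral_of_nonneg_ae (.of_forall hg0) hg.aestronglyMeasurable]
  refine ENNReal.toReal_mono hg.lintegral_lt_top.ne ?_
  rw [lintegral_eq_lintegral_meas_lt μ (.of_forall hf0) hf.aemeasurable,
    lintegral_eq_lintegral_meas_lt μ (.of_forall hg0) hg.aemeasurable]
  exact setLIntegral_mono' measurableSet_Ioi fun w hw => h w hw

/-- Jensen's inequality for an antitone nonnegative function which is log-convex on `[0, ∞)`. -/
theorem pow_card_le_prod_of_logConvex {ι : Type*} [Fintype ι] [Nonempty ι] {F : ℝ → ℝ}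
    (hF0 : ∀ x, 0 ≤ F x) (hanti : Antitone F)
    (hlogconvex : ∀ x ≥ (0 : ℝ), ∀ y ≥ (0 : ℝ), ∀ θ ∈ Set.Icc (0 : ℝ) 1,
      F (θ * x + (1 - θ) * y) ≤ F x ^ θ * F y ^ (1 - θ))
    {x : ι → ℝ} (hx : ∀ i, 0 ≤ x i) :
    F ((∑ i, x i) / Fintype.card ι) ^ Fintype.card ι ≤ ∏ i, F (x i) := by
  have hcard : (0 : ℝ) < Fintype.card ι := by exact_mod_cast Fintype.card_pos
  have hinv : (Fintype.card ι : ℝ)⁻¹ ∈ Set.Icc (0 : ℝ) 1 :=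
    ⟨by positivity, inv_le_one_of_one_le₀ (by exact_mod_cast Fintype.card_pos)⟩
  by_cases hpos : ∀ i, 0 < F (x i)
  · have hmean : ∑ i, (Fintype.card ι : ℝ)⁻¹ • x i = (∑ i, x i) / Fintype.card ι := by
      simp only [smul_eq_mul, ← Finset.mul_sum]
      ring
    have hconv : ConvexOn ℝ {y | 0 ≤ y ∧ 0 < F y} fun y => Real.log (F y) := by
      have hset : Convex ℝ {y | 0 ≤ y ∧ 0 < F y} := by
        refine Set.OrdConnected.convex ⟨?_⟩
        rintro a ⟨ha, -⟩ b ⟨-, hb⟩ y ⟨hay, hyb⟩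
        exact ⟨ha.trans hay, hb.trans_le (hanti hyb)⟩
      refine ⟨hset, ?_⟩
      rintro a ha b hb p q hp hq hpq
      have hmem := hset ha hb hp hq hpq
      obtain rfl : q = 1 - p := by linarith
      simp only [smul_eq_mul] at hmem ⊢
      rw [← Real.log_rpow ha.2, ← Real.log_rpow hb.2,
        ← Real.log_mul (Real.rpow_pos_of_pos ha.2 _).ne' (Real.rpow_pos_of_pos hb.2 _).ne']
      exact Real.log_le_log hmem.2 (hlogconvex a ha.1 b hb.1 p ⟨hp, by linarith⟩)
    have hsum : ∑ _i : ι, (Fintype.card ι : ℝ)⁻¹ = 1 := by simp [hcard.ne']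
    have hmem := hconv.1.sum_mem (t := Finset.univ) (z := x) (fun _ _ => hinv.1) hsum
      fun i _ => ⟨hx i, hpos i⟩
    have hjensen := hconv.map_sum_le (t := Finset.univ) (p := x) (fun _ _ => hinv.1) hsum
      fun i _ => ⟨hx i, hpos i⟩
    rw [hmean] at hmem hjensen
    rw [← Real.log_le_log_iff (pow_pos hmem.2 _) (Finset.prod_pos fun i _ => hpos i),
      Real.log_pow, Real.log_prod fun i _ => (hpos i).ne']
    simp only [smul_eq_mul, ← Finset.mul_sum] at hjensen
    rwa [inv_mul_eq_div, le_div_iff₀' hcard] at hjensen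
  · push Not at hpos
    obtain ⟨i, hi⟩ := hpos
    have hi0 : F (x i) = 0 := le_antisymm hi (hF0 _)
    have hle : (Fintype.card ι : ℝ)⁻¹ * x i + (1 - (Fintype.card ι : ℝ)⁻¹) * 0
        ≤ (∑ j, x j) / Fintype.card ι := by
      rw [mul_zero, add_zero, div_eq_inv_mul]
      exact mul_le_mul_of_nonneg_left
        (Finset.single_le_sum (fun j _ => hx j) (Finset.mem_univ i)) hinv.1
    have hzero := (hanti hle).trans (hlogconvex (x i) (hx i) 0 le_rfl _ hinv)
    rw [hi0, Real.zero_rpow (inv_pos.2 hcard).ne', zero_mul] at hzero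
    rw [le_antisymm hzero (hF0 _), zero_pow Fintype.card_ne_zero]
    exact Finset.prod_nonneg fun j _ => hF0 _

/-- The tail of a minimum of shifted i.i.d. random variables is the product of shifted tails. -/
theorem measure_lt_iInf_add {Ω ι : Type*} [MeasurableSpace Ω] {μ : Measure Ω} [Fintype ι]
    [Nonempty ι] {X : ι → Ω → ℝ} {Y : Ω → ℝ}
    (hindep : iIndepFun (m := fun _ => Real.measurableSpace) X μ)
    (hident : ∀ i, IdentDistrib (X i) Y μ μ) (c : ι → ℝ) (s : ℝ) :
    μ {ω | s < ⨅ i, (X i ω + c i)} = ∏ i, μ {ω | Y ω > s - c i} := by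
  have hset : {ω | s < ⨅ i, (X i ω + c i)}
      = ⋂ i ∈ (Finset.univ : Finset ι), X i ⁻¹' Set.Ioi (s - c i) := by
    ext ω
    have hiff : s < ⨅ i, (X i ω + c i) ↔ ∀ i, s < X i ω + c i := by
      refine ⟨fun h i => h.trans_le (ciInf_le (Set.finite_range _).bddBelow i), fun h => ?_⟩
      obtain ⟨i, hi⟩ := exists_eq_ciInf_of_finite (f := fun i => X i ω + c i)
      exact hi ▸ h i
    simp [hiff, sub_lt_iff_lt_add]
  rw [hset, hindep.measure_inter_preimage_eq_mul Finset.univ fun i _ => measurableSet_Ioi]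
  exact Finset.prod_congr rfl fun i _ => (hident i).measure_mem_eq measurableSet_Ioi

/-- Theorem 3 (log-convex, lower bound): for i.i.d. nonnegative integrable task
service times `X₁, …, X_r` whose common tail `F̄(x) = P(X > x)` is log-convex on
`[0, ∞)`, relative task start times `0 = t₁ ≤ t₂ ≤ … ≤ t_r`,
`S = min_i (Xᵢ + tᵢ)` and computing cost `C = Σᵢ max(S − tᵢ, 0)`, we have
`E[C] ≥ r · E[X_{1:r}]`. -/
theorem expected_cost_ge_of_logConvex_tail
    {Ω : Type*} [MeasurableSpace Ω] (μ : Measure Ω) [IsProbabilityMeasure μ]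
    {r : ℕ} (hr : 0 < r)
    (X : Fin r → Ω → ℝ) (hX : ∀ i, Measurable (X i))
    (hindep : iIndepFun (m := fun _ => Real.measurableSpace) X μ)
    (hident : ∀ i, IdentDistrib (X i) (X ⟨0, hr⟩) μ μ)
    (hnonneg : ∀ i ω, 0 ≤ X i ω)
    (hint : Integrable (X ⟨0, hr⟩) μ)
    (F : ℝ → ℝ) (hF : ∀ x, F x = (μ {ω | X ⟨0, hr⟩ ω > x}).toReal)
    (hlogconvex : ∀ x ≥ (0:ℝ), ∀ y ≥ (0:ℝ), ∀ θ ∈ Set.Icc (0:ℝ) 1,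
      F (θ * x + (1 - θ) * y) ≤ F x ^ θ * F y ^ (1 - θ))
    (t : Fin r → ℝ) (ht0 : t ⟨0, hr⟩ = 0) (htmono : Monotone t)
    (S : Ω → ℝ) (hS : ∀ ω, S ω = ⨅ i, (X i ω + t i))
    (C : Ω → ℝ) (hC : ∀ ω, C ω = ∑ i, max (S ω - t i) 0) :
    (r : ℝ) * ∫ ω, (⨅ i, X i ω) ∂μ ≤ ∫ ω, C ω ∂μ := by
  have : Nonempty (Fin r) := ⟨⟨0, hr⟩⟩
  have hr' : (0 : ℝ) < r := by exact_mod_cast hr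
  have ht : ∀ i, 0 ≤ t i := fun i => ht0 ▸ htmono (Fin.mk_le_of_le_val (Nat.zero_le _))
  have hF0 : ∀ x, 0 ≤ F x := fun x => hF x ▸ ENNReal.toReal_nonneg
  have hanti : Antitone F := fun a b hab => by
    rw [hF, hF]
    exact measureReal_mono fun ω hω => lt_of_le_of_lt hab hω
  have htail : ∀ (c : Fin r → ℝ) (s : ℝ),
      μ {ω | s < ⨅ i, (X i ω + c i)} = ENNReal.ofReal (∏ i, F (s - c i)) := fun c s => by
    rw [measure_lt_iInf_add hindep hident, ENNReal.ofReal_prod_of_nonneg fun i _ => hF0 _]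
    simp [hF]
  have hSmeas : Measurable S := by
    rw [funext hS]
    exact Measurable.iInf fun i => (hX i).add_const _
  have hCmeas : Measurable C := by
    rw [funext hC]
    fun_prop
  have hC0 : ∀ ω, 0 ≤ C ω := fun ω => hC ω ▸ Finset.sum_nonneg fun i _ => le_max_right _ _
  have hCint : Integrable C μ := by
    refine (hint.const_mul (r : ℝ)).mono' hCmeas.aestronglyMeasurable (.of_forall fun ω => ?_)
    have hSX : S ω ≤ X ⟨0, hr⟩ ω := by
      have := ciInf_le (Set.finite_range fun i => X i ω + t i).bddBelow ⟨0, hr⟩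
      rwa [← hS, ht0, add_zero] at this
    rw [Real.norm_of_nonneg (hC0 ω), hC]
    refine (Finset.sum_le_card_nsmul _ _ (X ⟨0, hr⟩ ω) fun i _ => ?_).trans_eq (by simp)
    exact max_le (by linarith [ht i]) (hnonneg _ ω)
  rw [← integral_const_mul]
  refine integral_le_integral_of_measure_lt_le
    ((Measurable.iInf hX).const_mul _) (fun ω => ?_) hCint hC0 fun w hw => ?_
  · exact mul_nonneg hr'.le (le_ciInf fun i => hnonneg i ω)
  obtain ⟨s, hs, hsw⟩ : ∃ s ≥ (0 : ℝ), ∑ i, max (s - t i) 0 = w := by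
    have hcont : ContinuousOn (fun s : ℝ => ∑ i, max (s - t i) 0) (Set.Icc 0 w) := by
      fun_prop
    have hw0 : ∑ i, max (0 - t i) 0 ≤ w := by simpa [ht] using hw.le
    have hww : w ≤ ∑ i, max (w - t i) 0 := by
      refine le_trans ?_ (Finset.single_le_sum (f := fun i => max (w - t i) 0)
        (fun i _ => le_max_right _ _) (Finset.mem_univ ⟨0, hr⟩))
      simp [ht0]
    obtain ⟨s, hs, hsw⟩ := intermediate_value_Icc hw.le hcont ⟨hw0, hww⟩
    exact ⟨s, hs.1, hsw⟩
  calc μ {ω | w < r * ⨅ i, X i ω}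
      = μ {ω | w / r < ⨅ i, (X i ω + 0)} := by simp only [add_zero, div_lt_iff₀' hr']
    _ = ENNReal.ofReal (F (w / r) ^ r) := by rw [htail fun _ => 0]; simp
    _ ≤ ENNReal.ofReal (∏ i, F (s - t i)) := by
        refine ENNReal.ofReal_le_ofReal ?_
        have hjensen := pow_card_le_prod_of_logConvex hF0 hanti hlogconvex
          (x := fun i => max (s - t i) 0) fun i => le_max_right _ _
        rw [hsw, Fintype.card_fin] at hjensen
        refine hjensen.trans (Finset.prod_le_prod (fun i _ => hF0 _) fun i _ => ?_)
        exact hanti (le_max_left _ _)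
    _ = μ {ω | s < S ω} := by simp only [hS, htail t]
    _ ≤ μ {ω | w < C ω} := by
        refine measure_mono fun ω (hω : s < S ω) => ?_
        rw [Set.mem_ofPred_eq, hC, ← hsw]
        refine Finset.sum_lt_sum (fun i _ => by gcongr) ⟨⟨0, hr⟩, Finset.mem_univ _, ?_⟩
        rw [ht0, sub_zero, sub_zero, max_eq_left hs, max_eq_left (hs.trans hω.le)]
        exact hω
end

section
/- (Corollary 1, monotonicity of fork-join latency in n) Let X₁, X₂, … be i.i.d. nonnegative random variables with E[X₁²] < ∞, let X_{1:n} = min(X₁, …, Xₙ), and let λ > 0. Define the (n,1) fork-join latency by the Pollaczek–Khinchine expression T(n) = E[X_{1:n}] + λ·E[X_{1:n}²] / (2·(1 − λ·E[X_{1:n}])). If λ·E[X_{1:n}] < 1, then λ·E[X_{1:(n+1)}] < 1 and T(n+1) ≤ T(n); that is, the expected latency of the (n,1) fork-join system is non-increasing in n for any service time distribution. -/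
open MeasureTheory ProbabilityTheory

/-- The minimum of the first `n` terms of a nonnegative real sequence decreases with `n ≥ 1`. -/
lemma iInf_fin_succ_le {x : ℕ → ℝ} (hx : ∀ i, 0 ≤ x i) {n : ℕ} (hn : 1 ≤ n) :
    ⨅ i : Fin (n + 1), x i ≤ ⨅ i : Fin n, x i := by
  have : Nonempty (Fin n) := ⟨⟨0, hn⟩⟩
  exact le_ciInf fun i => ciInf_le ⟨0, by rintro _ ⟨j, rfl⟩; exact hx j⟩ i.castSucc

/-- The minimum of the first `n ≥ 1` terms of a nonnegative square-integrable sequence is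
square-integrable. -/
lemma memLp_two_iInf_fin {Ω : Type*} [MeasurableSpace Ω] {μ : Measure Ω} {X : ℕ → Ω → ℝ}
    (hX : ∀ i, Measurable (X i)) (hnonneg : ∀ i ω, 0 ≤ X i ω) (hL2 : MemLp (X 0) 2 μ)
    {n : ℕ} (hn : 1 ≤ n) : MemLp (fun ω => ⨅ i : Fin n, X i ω) 2 μ := by
  refine hL2.mono (Measurable.iInf fun i : Fin n => hX i).aestronglyMeasurable
    (ae_of_all _ fun ω => ?_)
  rw [Real.norm_of_nonneg (Real.iInf_nonneg fun i : Fin n => hnonneg i ω),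
    Real.norm_of_nonneg (hnonneg 0 ω)]
  exact ciInf_le (f := fun i : Fin n => X i ω)
    ⟨0, by rintro _ ⟨j, rfl⟩; exact hnonneg j ω⟩ ⟨0, hn⟩

/-- The Pollaczek–Khinchine expression is monotone in the first two service-time moments. -/
lemma pollaczek_khinchine_mono {lam a b a₂ b₂ : ℝ} (hlam : 0 ≤ lam) (hab : a ≤ b)
    (hab₂ : a₂ ≤ b₂) (hb₂ : 0 ≤ b₂) (hb : lam * b < 1) :
    a + lam * a₂ / (2 * (1 - lam * a)) ≤ b + lam * b₂ / (2 * (1 - lam * b)) := by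
  have : 0 < 2 * (1 - lam * b) := by linarith
  gcongr

/-- Corollary 1: for i.i.d. nonnegative service times `X₁, X₂, …` with
`E[X₁²] < ∞` and arrival rate `λ > 0`, the Pollaczek–Khinchine latency
`T(n) = E[X_{1:n}] + λ·E[X_{1:n}²] / (2(1 − λ·E[X_{1:n}]))` of the `(n,1)`
fork-join system is non-increasing in `n`: if the system is stable at `n`
(`λ·E[X_{1:n}] < 1`), then it is stable at `n+1` and `T(n+1) ≤ T(n)`. -/
theorem fork_join_latency_antitone
    {Ω : Type*} [MeasurableSpace Ω] (μ : Measure Ω) [IsProbabilityMeasure μ]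
    (X : ℕ → Ω → ℝ) (hX : ∀ i, Measurable (X i))
    (hindep : iIndepFun (m := fun _ => Real.measurableSpace) X μ)
    (hident : ∀ i, IdentDistrib (X i) (X 0) μ μ)
    (hnonneg : ∀ i ω, 0 ≤ X i ω)
    (hsq : Integrable (fun ω => (X 0 ω) ^ 2) μ)
    (lam : ℝ) (hlam : 0 < lam)
    (M M2 T : ℕ → ℝ)
    (hM : ∀ n, M n = ∫ ω, (⨅ i : Fin n, X i ω) ∂μ)
    (hM2 : ∀ n, M2 n = ∫ ω, (⨅ i : Fin n, X i ω) ^ 2 ∂μ)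
    (hT : ∀ n, T n = M n + lam * M2 n / (2 * (1 - lam * M n))) :
    ∀ n : ℕ, 1 ≤ n → lam * M n < 1 →
      lam * M (n + 1) < 1 ∧ T (n + 1) ≤ T n := by
  intro n hn hstable
  have hL2 : MemLp (X 0) 2 μ :=
    (memLp_two_iff_integrable_sq (hX 0).aestronglyMeasurable).2 hsq
  have hmem {k : ℕ} (hk : 1 ≤ k) := memLp_two_iInf_fin hX hnonneg hL2 hk
  have hle (ω : Ω) := iInf_fin_succ_le (fun i => hnonneg i ω) hn
  have hn' : 1 ≤ n + 1 := Nat.le_add_left 1 n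
  have hMle : M (n + 1) ≤ M n := by
    rw [hM, hM]
    exact integral_mono ((hmem hn').integrable one_le_two) ((hmem hn).integrable one_le_two) hle
  have hM2le : M2 (n + 1) ≤ M2 n := by
    rw [hM2, hM2]
    exact integral_mono (hmem hn').integrable_sq (hmem hn).integrable_sq fun ω =>
      pow_le_pow_left₀ (Real.iInf_nonneg fun i : Fin (n + 1) => hnonneg i ω) (hle ω) 2
  have hM2nonneg : 0 ≤ M2 n := by
    rw [hM2]
    exact integral_nonneg fun ω => sq_nonneg _
  refine ⟨(mul_le_mul_of_nonneg_left hMle hlam.le).trans_lt hstable, ?_⟩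
  rw [hT, hT]
  exact pollaczek_khinchine_mono hlam.le hMle hM2le hM2nonneg hstable
end

section
/- (Cost of redundancy under shifted exponential service) Let Δ > 0 and μ > 0, and let X₁, …, Xₙ be i.i.d. random variables distributed as ShiftedExp(Δ, μ), i.e., Xᵢ = Δ + Eᵢ with Eᵢ i.i.d. exponential of rate μ. Then X_{1:n} = min(X₁, …, Xₙ) satisfies E[X_{1:n}] = Δ + 1/(nμ), and the expected computing cost of the (n,1) fork-join system is n · E[X_{1:n}] = nΔ + 1/μ, which is strictly increasing in n; that is, for shifted exponential service time with Δ > 0, adding more replicas strictly increases the expected computing cost. -/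
open MeasureTheory ProbabilityTheory

/-- The tail function of `ShiftedExp(Δ, a)` is integrable on `(0, ∞)`, with integral `Δ + 1 / a`. -/
lemma integrableOn_and_integral_shiftedExp_tail {Δ a : ℝ} (hΔ : 0 ≤ Δ) (ha : 0 < a) :
    IntegrableOn (fun x => min 1 (Real.exp (-a * (x - Δ)))) (Set.Ioi 0) ∧
      ∫ x in Set.Ioi 0, min 1 (Real.exp (-a * (x - Δ))) = Δ + 1 / a := by
  have hexp (x : ℝ) : Real.exp (-a * (x - Δ)) = Real.exp (a * Δ) * Real.exp (-a * x) := by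
    rw [← Real.exp_add]; ring_nf
  have hleft : Set.EqOn (fun x => min 1 (Real.exp (-a * (x - Δ)))) (fun _ => 1)
      (Set.Ioc 0 Δ) := fun x hx => by
    refine min_eq_left (Real.one_le_exp ?_)
    nlinarith [hx.2]
  have hright : Set.EqOn (fun x => min 1 (Real.exp (-a * (x - Δ))))
      (fun x => Real.exp (a * Δ) * Real.exp (-a * x)) (Set.Ioi Δ) := fun x hx => by
    have hx' : Δ < x := hx
    simp only [← hexp]
    refine min_eq_right (Real.exp_le_one_iff.2 ?_)
    nlinarith
  have hintLeft : IntegrableOn (fun x => min 1 (Real.exp (-a * (x - Δ)))) (Set.Ioc 0 Δ) :=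
    (integrableOn_congr_fun hleft measurableSet_Ioc).2 (integrableOn_const (by simp))
  have hintRight : IntegrableOn (fun x => min 1 (Real.exp (-a * (x - Δ)))) (Set.Ioi Δ) :=
    (integrableOn_congr_fun hright measurableSet_Ioi).2
      ((integrableOn_exp_mul_Ioi (neg_lt_zero.2 ha) Δ).const_mul _)
  rw [← Set.Ioc_union_Ioi_eq_Ioi hΔ]
  refine ⟨hintLeft.union hintRight, ?_⟩
  rw [setIntegral_union (Set.Ioc_disjoint_Ioi le_rfl) measurableSet_Ioi hintLeft hintRight,
    setIntegral_congr_fun measurableSet_Ioc hleft, setIntegral_congr_fun measurableSet_Ioi hright,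
    integral_const_mul, integral_exp_mul_Ioi (neg_lt_zero.2 ha), neg_div_neg_eq, ← mul_div_assoc,
    ← Real.exp_add]
  simp [hΔ]

/-- The tail of the minimum of finitely many independent random variables is the product of
their tails. -/
lemma ProbabilityTheory.iIndepFun.measure_lt_iInf {Ω ι : Type*} [MeasurableSpace Ω] [Fintype ι]
    [Nonempty ι] {μ : Measure Ω} {X : ι → Ω → ℝ} (hindep : iIndepFun X μ) (x : ℝ) :
    μ {ω | x < ⨅ i, X i ω} = ∏ i, μ {ω | x < X i ω} := by
  have hset : {ω | x < ⨅ i, X i ω} = ⋂ i ∈ (Finset.univ : Finset ι), X i ⁻¹' Set.Ioi x := by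
    ext ω
    simp [iInf, (Set.finite_range fun i => X i ω).lt_csInf_iff (Set.range_nonempty _)]
  rw [hset, hindep.measure_inter_preimage_eq_mul Finset.univ fun _ _ => measurableSet_Ioi]
  rfl

/-- A real random variable with the tail of `ShiftedExp(Δ, a)` has mean `Δ + 1 / a`. -/
lemma integral_eq_of_shiftedExp_tail {Ω : Type*} [MeasurableSpace Ω] {μ : Measure Ω}
    [IsProbabilityMeasure μ] {Δ a : ℝ} (hΔ : 0 ≤ Δ) (ha : 0 < a) {Y : Ω → ℝ} (hY : Measurable Y)
    (htail : ∀ x ≥ (0 : ℝ), μ {ω | x < Y ω} = ENNReal.ofReal (min 1 (Real.exp (-a * (x - Δ))))) :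
    ∫ ω, Y ω ∂μ = Δ + 1 / a := by
  obtain ⟨hint, hval⟩ := integrableOn_and_integral_shiftedExp_tail hΔ ha
  have hpos : ∀ᵐ ω ∂μ, 0 < Y ω := by
    refine (mem_ae_iff_prob_eq_one (measurableSet_lt measurable_const hY)).2 ?_
    rw [htail 0 le_rfl, min_eq_left (Real.one_le_exp (by nlinarith)), ENNReal.ofReal_one]
  have hnonneg : 0 ≤ᵐ[μ] Y := hpos.mono fun _ h => h.le
  rw [integral_eq_lintegral_of_nonneg_ae hnonneg hY.aestronglyMeasurable,
    lintegral_eq_lintegral_meas_lt μ hnonneg hY.aemeasurable,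
    setLIntegral_congr_fun measurableSet_Ioi fun x hx => htail x (le_of_lt hx),
    ← ofReal_integral_eq_lintegral_ofReal hint
      (ae_of_all _ fun x => le_min zero_le_one (Real.exp_nonneg _)), hval,
    ENNReal.toReal_ofReal (by positivity)]

/-- The minimum of `n` independent `ShiftedExp(Δ, m)` variables has mean `Δ + 1 / (n * m)`. -/
lemma integral_iInf_shiftedExp {Ω : Type*} [MeasurableSpace Ω] {μ : Measure Ω}
    [IsProbabilityMeasure μ] {Δ m : ℝ} (hΔ : 0 ≤ Δ) (hm : 0 < m) {n : ℕ} (hn : 1 ≤ n)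
    {X : Fin n → Ω → ℝ} (hX : ∀ i, Measurable (X i)) (hindep : iIndepFun X μ)
    (htail : ∀ i, ∀ x ≥ (0 : ℝ),
      (μ {ω | X i ω > x}).toReal = min 1 (Real.exp (-m * (x - Δ)))) :
    ∫ ω, (⨅ i, X i ω) ∂μ = Δ + 1 / (n * m) := by
  have : NeZero n := ⟨by lia⟩
  refine integral_eq_of_shiftedExp_tail hΔ (by positivity) (Measurable.iInf hX) fun x hx => ?_
  have htail' (i : Fin n) :
      μ {ω | x < X i ω} = ENNReal.ofReal (min 1 (Real.exp (-m * (x - Δ)))) := by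
    rw [← htail i x hx, ENNReal.ofReal_toReal (measure_ne_top _ _)]
  have hpow : (min 1 (Real.exp (-m * (x - Δ)))) ^ n = min 1 (Real.exp (-(n * m) * (x - Δ))) := by
    rw [show -(n * m) * (x - Δ) = n * (-m * (x - Δ)) by ring, Real.exp_nat_mul]
    rcases le_total 1 (Real.exp (-m * (x - Δ))) with h | h
    · rw [min_eq_left h, min_eq_left (one_le_pow₀ h), one_pow]
    · rw [min_eq_right h, min_eq_right (pow_le_one₀ (Real.exp_nonneg _) h)]
  rw [hindep.measure_lt_iInf, Finset.prod_congr rfl fun i _ => htail' i, Finset.prod_const,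
    Finset.card_univ, Fintype.card_fin,
    ← ENNReal.ofReal_pow (le_min zero_le_one (Real.exp_nonneg _)), hpow]

/-- For i.i.d. service times `X₁, X₂, …` distributed as `ShiftedExp(Δ, μ)` with
`Δ > 0` and rate `μ > 0` (tail `P(Xᵢ > x) = min(1, e^{−μ(x−Δ)})` for `x ≥ 0`),
the minimum `X_{1:n} = min(X₁, …, Xₙ)` satisfies `E[X_{1:n}] = Δ + 1/(nμ)`,
the expected computing cost of the `(n,1)` fork-join system is
`n · E[X_{1:n}] = nΔ + 1/μ`, and this cost is strictly increasing in `n`. -/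
theorem shiftedExp_fork_join_cost_strictMono
    {Ω : Type*} [MeasurableSpace Ω] (μ : Measure Ω) [IsProbabilityMeasure μ]
    (Δ m : ℝ) (hΔ : 0 < Δ) (hm : 0 < m)
    (X : ℕ → Ω → ℝ) (hX : ∀ i, Measurable (X i))
    (hindep : iIndepFun (m := fun _ => Real.measurableSpace) X μ)
    (htail : ∀ i, ∀ x ≥ (0:ℝ),
      (μ {ω | X i ω > x}).toReal = min 1 (Real.exp (-m * (x - Δ)))) :
    (∀ n : ℕ, 1 ≤ n →
      (∫ ω, (⨅ i : Fin n, X i ω) ∂μ) = Δ + 1 / (n * m) ∧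
      (n : ℝ) * ∫ ω, (⨅ i : Fin n, X i ω) ∂μ = n * Δ + 1 / m) ∧
    (∀ n₁ n₂ : ℕ, 1 ≤ n₁ → n₁ < n₂ →
      (n₁ : ℝ) * ∫ ω, (⨅ i : Fin n₁, X i ω) ∂μ <
        (n₂ : ℝ) * ∫ ω, (⨅ i : Fin n₂, X i ω) ∂μ) := by
  have hmean (n : ℕ) (hn : 1 ≤ n) : ∫ ω, (⨅ i : Fin n, X i ω) ∂μ = Δ + 1 / (n * m) :=
    integral_iInf_shiftedExp hΔ.le hm hn (fun i => hX i) (hindep.precomp Fin.val_injective)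
      fun i => htail i
  have hcost (n : ℕ) (hn : 1 ≤ n) :
      (n : ℝ) * ∫ ω, (⨅ i : Fin n, X i ω) ∂μ = n * Δ + 1 / m := by
    have : (n : ℝ) ≠ 0 := by positivity
    rw [hmean n hn]
    field_simp
  refine ⟨fun n hn => ⟨hmean n hn, hcost n hn⟩, fun n₁ n₂ h₁ h₁₂ => ?_⟩
  rw [hcost n₁ h₁, hcost n₂ (h₁.trans h₁₂.le)]
  gcongr
end
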